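/- An aperiodic binary sequence s is Sturmian if and only if there exists a binary sequence u such that 0·u ≤ T^k(s) ≤ 1·u for all k ≥ 0 (lexicographic order). Moreover, when s is Sturmian, the sequence u with this property is unique; it is characteristic Sturmian, i.e., there is an irrational α ∈ (0,1) such that u(n) = ⌊(n+2)α⌋ − ⌊(n+1)α⌋ for all n ≥ 0; and every finite prefix of 0·u and every finite prefix of 1·u is a factor of s (so that 0·u and 1·u are, respectively, the infimum and supremum of the set {T^k(s) : k ≥ 0} for the lexicographic order). -/

import Mathlib

/-- The finite word `s(i) s(i+1) ⋯ s(i+k−1)`. -/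
def window {A : Type*} (s : ℕ → A) (i k : ℕ) : List A :=
  (List.range k).map fun j => s (i + j)

/-- `l` is a factor of the sequence `s`. -/
def IsFactor {A : Type*} (s : ℕ → A) (l : List A) : Prop :=
  ∃ i, l = window s i l.length

/-- The number of distinct factors of `s` of length `k` (complexity function). -/
noncomputable def complexity {A : Type*} (s : ℕ → A) (k : ℕ) : ℕ :=
  Set.ncard {l : List A | l.length = k ∧ IsFactor s l}

/-- The shift map. -/
def shiftMap {A : Type*} (s : ℕ → A) : ℕ → A := fun n => s (n + 1)

/-- The sequence `x·u`. -/
def pre {A : Type*} (x : A) (u : ℕ → A) : ℕ → A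
  | 0 => x
  | n + 1 => u n

/-- Strict lexicographic order on sequences. -/
def SeqLt {A : Type*} [LT A] (u v : ℕ → A) : Prop :=
  ∃ i, (∀ j < i, u j = v j) ∧ u i < v i

/-- Lexicographic order on sequences. -/
def SeqLe {A : Type*} [LT A] (u v : ℕ → A) : Prop :=
  (∀ n, u n = v n) ∨ SeqLt u v

/-- Lexicographic order on (equal-length) finite words. -/
def WordLe {A : Type*} [LT A] (u v : List A) : Prop :=
  u = v ∨ List.Lex (· < ·) u v

def UltimatelyPeriodic {A : Type*} (s : ℕ → A) : Prop :=
  ∃ N, ∃ q ≥ 1, ∀ n ≥ N, s (n + q) = s n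

/-- A binary sequence is Sturmian if it has complexity `k + 1` for all `k ≥ 1`. -/
def Sturmian (s : ℕ → Fin 2) : Prop :=
  ∀ k ≥ 1, complexity s k = k + 1

/-- `w` is a left special factor of `s`. -/
def LeftSpecial {A : Type*} (s : ℕ → A) (w : List A) : Prop :=
  ∃ x y : A, x ≠ y ∧ IsFactor s (x :: w) ∧ IsFactor s (y :: w)

/-- A binary sequence is balanced. -/
def BalancedSeq (s : ℕ → Fin 2) : Prop :=
  ∀ u v : List (Fin 2), IsFactor s u → IsFactor s v → u.length = v.length →
    ((u.count 1 : ℤ) - (v.count 1 : ℤ)).natAbs ≤ 1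

/-- `u` is the characteristic Sturmian sequence of slope `α`. -/
def IsCharSturmian (α : ℝ) (u : ℕ → Fin 2) : Prop :=
  ∀ n : ℕ, ((u n : ℕ) : ℤ) = ⌊((n : ℝ) + 2) * α⌋ - ⌊((n : ℝ) + 1) * α⌋


theorem window_eq_iff (s : ℕ → Fin 2) (t : ℕ → Fin 2) (a b k : ℕ) :
    window s a k = window t b k ↔ ∀ j < k, s (a + j) = t (b + j) := by
  simp [window]

theorem window_len (s : ℕ → Fin 2) (a k : ℕ) : (window s a k).length = k := by
  simp [window]

theorem window_succ' (s : ℕ → Fin 2) (a k : ℕ) :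
    window s a (k + 1) = window s a k ++ [s (a + k)] := by
  simp [window, List.range_succ]

theorem factorSet_eq (s : ℕ → Fin 2) (k : ℕ) :
    {l : List (Fin 2) | l.length = k ∧ IsFactor s l} = Set.range (fun i => window s i k) := by
  ext l
  constructor
  · rintro ⟨h1, i, h2⟩
    exact ⟨i, by simp only; rw [h2, ← h1]⟩
  · rintro ⟨i, rfl⟩
    exact ⟨window_len _ _ _, i, by simp only; rw [window_len]⟩

theorem range_fin (s : ℕ → Fin 2) (k : ℕ) : (Set.range (fun i => window s i k)).Finite := by
  apply (List.finite_length_eq (Fin 2) k).subset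
  rintro _ ⟨i, rfl⟩
  exact window_len _ _ _

def RSp (s : ℕ → Fin 2) (k : ℕ) : Set (List (Fin 2)) :=
  {w | ∃ a b, w = window s a k ∧ w = window s b k ∧ s (a + k) = 0 ∧ s (b + k) = 1}

theorem complexity_succ (s : ℕ → Fin 2) (k : ℕ) :
    complexity s (k + 1) = complexity s k + (RSp s k).ncard := by
  unfold complexity
  rw [factorSet_eq, factorSet_eq]
  let A : Fin 2 → Set (List (Fin 2)) := fun x => {w | ∃ a, w = window s a k ∧ s (a + k) = x}
  have hsub : ∀ x, A x ⊆ Set.range (fun i => window s i k) := by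
    rintro x w ⟨a, rfl, _⟩
    exact ⟨a, rfl⟩
  have hfin : ∀ x, (A x).Finite := fun x => (range_fin s k).subset (hsub x)
  have h1 : Set.range (fun i => window s i k) = A 0 ∪ A 1 := by
    apply Set.Subset.antisymm
    · rintro _ ⟨a, rfl⟩
      rcases (by omega : s (a + k) = 0 ∨ s (a + k) = 1) with h | h
      · left; exact ⟨a, rfl, h⟩
      · right; exact ⟨a, rfl, h⟩
    · exact Set.union_subset (hsub 0) (hsub 1)
  have h2 : RSp s k = A 0 ∩ A 1 := by
    ext w
    constructor
    · rintro ⟨a, b, h1, h2, h3, h4⟩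
      exact ⟨⟨a, h1, h3⟩, ⟨b, h2, h4⟩⟩
    · rintro ⟨⟨a, h1, h3⟩, ⟨b, h2, h4⟩⟩
      exact ⟨a, b, h1, h2, h3, h4⟩
  have h3 : Set.range (fun i => window s i (k + 1)) =
      (fun w => w ++ [0]) '' A 0 ∪ (fun w => w ++ [1]) '' A 1 := by
    ext w
    constructor
    · rintro ⟨a, rfl⟩
      simp only [window_succ']
      rcases (by omega : s (a + k) = 0 ∨ s (a + k) = 1) with h | h
      · left; exact ⟨_, ⟨a, rfl, h⟩, by rw [h]⟩
      · right; exact ⟨_, ⟨a, rfl, h⟩, by rw [h]⟩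
    · rintro (⟨_, ⟨a, rfl, h⟩, rfl⟩ | ⟨_, ⟨a, rfl, h⟩, rfl⟩)
      · exact ⟨a, by simp only [window_succ', h]⟩
      · exact ⟨a, by simp only [window_succ', h]⟩
  rw [h3, h1, h2, Set.ncard_union_add_ncard_inter _ _ (hfin 0) (hfin 1)]
  rw [Set.ncard_union_eq _ ((hfin 0).image _) ((hfin 1).image _)]
  · rw [Set.ncard_image_of_injective _ (List.append_left_injective _),
      Set.ncard_image_of_injective _ (List.append_left_injective _)]
  · rw [Set.disjoint_left]
    rintro w ⟨x, _, rfl⟩ ⟨y, _, h⟩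
    simp at h

theorem complexity_zero (s : ℕ → Fin 2) : complexity s 0 = 1 := by
  unfold complexity
  rw [factorSet_eq]
  simp [window]

theorem RSp_fin (s : ℕ → Fin 2) (k : ℕ) : (RSp s k).Finite := by
  apply (range_fin s k).subset
  rintro w ⟨a, b, h, _⟩
  exact ⟨a, h.symm⟩

theorem next_eq (s : ℕ → Fin 2) (k a b : ℕ) (h : window s a k = window s b k)
    (hn : window s a k ∉ RSp s k) : window s (a + 1) k = window s (b + 1) k := by
  have h1 : s (a + k) = s (b + k) := by
    by_contra hne
    rcases (by omega : (s (a + k) = 0 ∧ s (b + k) = 1) ∨ (s (a + k) = 1 ∧ s (b + k) = 0)) with h' | h'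
    · exact hn ⟨a, b, rfl, h, h'.1, h'.2⟩
    · exact hn ⟨b, a, h, rfl, h'.2, h'.1⟩
  rw [window_eq_iff] at h ⊢
  intro j hj
  by_cases hjk : j + 1 < k
  · have := h (j + 1) hjk
    rwa [show a + (j + 1) = a + 1 + j by ring, show b + (j + 1) = b + 1 + j by ring] at this
  · have : k = j + 1 := by omega
    subst this
    rwa [show a + (j + 1) = a + 1 + j by ring, show b + (j + 1) = b + 1 + j by ring] at h1

theorem per_of (s : ℕ → Fin 2) (k a b : ℕ) (hab : a < b) (h : window s a k = window s b k)
    (hn : ∀ c, a ≤ c → c < b → window s c k ∉ RSp s k) : UltimatelyPeriodic s := by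
  have key : ∀ r, window s (a + r) k = window s (b + r) k ∧ window s (a + r) k ∉ RSp s k := by
    intro r
    induction r using Nat.strong_induction_on with
    | _ r ih =>
      have e : window s (a + r) k = window s (b + r) k := by
        rcases r with _ | r
        · exact h
        · have := ih r (by omega)
          exact next_eq s k (a + r) (b + r) this.1 this.2
      refine ⟨e, ?_⟩
      by_cases hr : r < b - a
      · exact hn _ (by omega) (by omega)
      · have := ih (r - (b - a)) (by omega)
        rw [this.1] at this
        rw [show b + (r - (b - a)) = a + r by omega] at this
        exact this.2
  have key2 : ∀ r, s (a + r) = s (b + r) := by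
    intro r
    rcases Nat.eq_zero_or_pos k with hk | hk
    · subst hk
      by_contra hne
      apply (key 0).2
      rcases (by omega : (s (a + r) = 0 ∧ s (b + r) = 1) ∨ (s (a + r) = 1 ∧ s (b + r) = 0)) with h' | h'
      · exact ⟨a + r, b + r, by simp [window], by simp [window], h'.1, h'.2⟩
      · exact ⟨b + r, a + r, by simp [window], by simp [window], h'.2, h'.1⟩
    · have := (window_eq_iff _ _ _ _ _).1 (key r).1 0 hk
      simpa using this
  refine ⟨a, b - a, by omega, fun n hn => ?_⟩
  have := key2 (n - a)
  rw [show a + (n - a) = n by omega, show b + (n - a) = n + (b - a) by omega] at this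
  exact this.symm

theorem RSp_nonempty (s : ℕ → Fin 2) (hap : ¬ UltimatelyPeriodic s) (k : ℕ) :
    (RSp s k).Nonempty := by
  by_contra hne
  rw [Set.not_nonempty_iff_eq_empty] at hne
  have := (range_fin s k)
  have h2 : ¬ Function.Injective (fun i => window s i k) := by
    intro hinj
    exact Set.infinite_range_of_injective hinj this
  simp only [Function.Injective, not_forall] at h2
  obtain ⟨a, b, h, hab⟩ := h2
  rcases lt_or_gt_of_ne hab with h' | h'
  · exact hap (per_of s k a b h' h (by simp [hne]))
  · exact hap (per_of s k b a h' h.symm (by simp [hne]))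

def SS (s : ℕ → Fin 2) (n : ℕ) : ℤ := ∑ i ∈ Finset.range n, ((s i : ℕ) : ℤ)

theorem SS_succ (s : ℕ → Fin 2) (n : ℕ) : SS s (n + 1) = SS s n + ((s n : ℕ) : ℤ) := by
  simp [SS, Finset.sum_range_succ]

theorem SS_zero (s : ℕ → Fin 2) : SS s 0 = 0 := by simp [SS]

def Bal (s : ℕ → Fin 2) : Prop :=
  ∀ i j n, SS s (i + n) - SS s i ≤ SS s (j + n) - SS s j + 1

theorem v01 (x : Fin 2) : ((x : ℕ) : ℤ) = 0 ∧ x = 0 ∨ ((x : ℕ) : ℤ) = 1 ∧ x = 1 := by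
  fin_cases x <;> simp

theorem v_inj (x y : Fin 2) (h : ((x : ℕ) : ℤ) = ((y : ℕ) : ℤ)) : x = y := by
  apply Fin.ext
  exact_mod_cast h

/-- minimal unbalanced pair -/
theorem unbal (s : ℕ → Fin 2) (h : ¬ Bal s) :
    ∃ i j n, s i = 1 ∧ s j = 0 ∧ s (i + (n + 1)) = 1 ∧ s (j + (n + 1)) = 0 ∧
      (∀ m < n, s (i + 1 + m) = s (j + 1 + m)) ∧
      (∀ m < n, s (i + 1 + m) = s (i + (n - m))) := by
  classical
  have hex : ∃ n, ∃ i j, SS s (j + n) - SS s j + 1 < SS s (i + n) - SS s i := by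
    unfold Bal at h
    push Not at h
    obtain ⟨i, j, n, h⟩ := h
    exact ⟨n, i, j, h⟩
  obtain ⟨i, j, hij⟩ := Nat.find_spec hex
  have hmin : ∀ m < Nat.find hex, ∀ i j, SS s (i + m) - SS s i ≤ SS s (j + m) - SS s j + 1 := by
    intro m hm i j
    have := Nat.find_min hex hm
    push Not at this
    exact this i j
  generalize Nat.find hex = N at hij hmin
  have hN2 : 2 ≤ N := by
    rcases N with _ | _ | N
    · simp at hij
    · simp only [zero_add, SS_succ] at hij
      rcases v01 (s i) with h1 | h1 <;> rcases v01 (s j) with h2 | h2 <;> omega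
    · omega
  obtain ⟨n, rfl⟩ : ∃ n, N = n + 2 := ⟨N - 2, by omega⟩
  have hmid : ∀ m, 1 ≤ m → m < n + 2 →
      SS s (i + m) - SS s i = SS s (j + m) - SS s j + 1 := by
    intro m h1 h2
    have a1 := hmin m h2 i j
    have a2 := hmin (n + 2 - m) (by omega) (i + m) (j + m)
    rw [show i + m + (n + 2 - m) = i + (n + 2) by omega,
      show j + m + (n + 2 - m) = j + (n + 2) by omega] at a2
    omega
  have e1 := hmid 1 (by omega) (by omega)
  rw [SS_succ, SS_succ] at e1
  have hi : s i = 1 ∧ s j = 0 := by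
    rcases v01 (s i) with h1 | h1 <;> rcases v01 (s j) with h2 | h2
    all_goals first | exact ⟨h1.2, h2.2⟩ | omega
  have e2 := hmid (n + 1) (by omega) (by omega)
  have e3 : SS s (i + (n + 2)) = SS s (i + (n + 1)) + ((s (i + (n + 1)) : ℕ) : ℤ) := SS_succ s _
  have e4 : SS s (j + (n + 2)) = SS s (j + (n + 1)) + ((s (j + (n + 1)) : ℕ) : ℤ) := SS_succ s _
  have hl : s (i + (n + 1)) = 1 ∧ s (j + (n + 1)) = 0 := by
    rcases v01 (s (i + (n + 1))) with h1 | h1 <;> rcases v01 (s (j + (n + 1))) with h2 | h2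
    all_goals first | exact ⟨h1.2, h2.2⟩ | omega
  have hsi : SS s (i + 1) = SS s i + 1 := by rw [SS_succ, hi.1]; simp
  have hsj : SS s (j + 1) = SS s j := by rw [SS_succ, hi.2]; simp
  rw [hl.1] at e3
  rw [hl.2] at e4
  simp at e3 e4
  refine ⟨i, j, n, hi.1, hi.2, hl.1, hl.2, ?_, ?_⟩
  · intro m hm
    have f1 := hmid (m + 1) (by omega) (by omega)
    have f2 := hmid (m + 2) (by omega) (by omega)
    have f3 : SS s (i + (m + 2)) = SS s (i + (m + 1)) + ((s (i + (m + 1)) : ℕ) : ℤ) := SS_succ s _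
    have f4 : SS s (j + (m + 2)) = SS s (j + (m + 1)) + ((s (j + (m + 1)) : ℕ) : ℤ) := SS_succ s _
    rw [show i + 1 + m = i + (m + 1) by ring, show j + 1 + m = j + (m + 1) by ring]
    apply v_inj
    omega
  · have hp : ∀ r ≤ n, SS s (i + 1 + r) - SS s (i + 1) =
        SS s (i + (n + 1)) - SS s (i + (n + 1) - r) := by
      intro r hr
      have g1 := hmin (r + 1) (by omega) (i + (n + 1) - r) j
      have g2 := hmin (r + 1) (by omega) i (j + (n + 1) - r)
      have g3 := hmid (r + 1) (by omega) (by omega)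
      have g4 := hmid (n + 1 - r) (by omega) (by omega)
      rw [show i + (n + 1) - r + (r + 1) = i + (n + 2) by omega] at g1
      rw [show j + (n + 1) - r + (r + 1) = j + (n + 2) by omega,
        show j + (n + 1) - r = j + (n + 1 - r) by omega] at g2
      rw [show i + 1 + r = i + (r + 1) by omega]
      rw [show i + (n + 1) - r = i + (n + 1 - r) by omega] at *
      omega
    intro m hm
    have k1 := hp m (by omega)
    have k2 := hp (m + 1) (by omega)
    have k3 : SS s (i + 1 + (m + 1)) = SS s (i + 1 + m) + ((s (i + 1 + m) : ℕ) : ℤ) := SS_succ s _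
    have k4 := SS_succ s (i + (n - m))
    rw [show i + (n - m) + 1 = i + (n + 1) - m by omega] at k4
    rw [show i + (n + 1) - (m + 1) = i + (n - m) by omega] at k2
    apply v_inj
    omega

theorem seqLe_iff (x y : ℕ → Fin 2) :
    SeqLe x y ↔ ∀ n, (∀ j < n, x j = y j) → x n ≤ y n := by
  constructor
  · rintro (h | ⟨i, h1, h2⟩) n hn
    · exact (h n).le
    · rcases lt_trichotomy n i with h | h | h
      · exact (h1 n h).le
      · subst h; exact h2.le
      · exact absurd (hn i h) h2.ne
  · intro h
    by_cases he : ∀ n, x n = y n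
    · exact Or.inl he
    · right
      push Not at he
      classical
      refine ⟨Nat.find he, fun j hj => ?_, ?_⟩
      · have := Nat.find_min he hj
        push Not at this
        exact this
      · refine lt_of_le_of_ne (h _ fun j hj => ?_) (Nat.find_spec he)
        have := Nat.find_min he hj
        push Not at this
        exact this

def LexC (s u : ℕ → Fin 2) : Prop := ∀ k : ℕ,
  SeqLe (pre 0 u) (shiftMap^[k] s) ∧ SeqLe (shiftMap^[k] s) (pre 1 u)

theorem shift_apply (s : ℕ → Fin 2) (k n : ℕ) : (shiftMap^[k] s) n = s (k + n) := by
  induction k generalizing s with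
  | zero => simp
  | succ k ih => rw [Function.iterate_succ_apply, ih]; simp only [shiftMap]; congr 1; ring

theorem lexC_iff (s u : ℕ → Fin 2) : LexC s u ↔
    (∀ k n, s k = 0 → (∀ m < n, u m = s (k + 1 + m)) → u n ≤ s (k + 1 + n)) ∧
    (∀ k n, s k = 1 → (∀ m < n, u m = s (k + 1 + m)) → s (k + 1 + n) ≤ u n) := by
  have e : ∀ k n, s (k + 1 + n) = s (k + (n + 1)) := fun k n => by congr 1; ring
  simp only [LexC, seqLe_iff, shift_apply]
  constructor
  · intro h
    refine ⟨fun k n hk hm => ?_, fun k n hk hm => ?_⟩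
    · have := (h k).1 (n + 1) (by
        rintro (_ | j) hj
        · simp [pre, hk]
        · rw [← e]; exact hm j (by omega))
      rw [e]; exact this
    · have := (h k).2 (n + 1) (by
        rintro (_ | j) hj
        · simp [pre, hk]
        · rw [← e]; exact (hm j (by omega)).symm)
      rw [e]; exact this
  · rintro ⟨h1, h2⟩ k
    constructor
    · rintro (_ | n) hn
      · simp [pre]
      · have := h1 k n (by simpa [pre] using (hn 0 (by omega)).symm)
          (fun m hm => by rw [e]; exact hn (m + 1) (by omega))
        rw [← e]; exact this
    · rintro (_ | n) hn
      · simp only [pre]; omega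
      · have := h2 k n (by simpa [pre] using (hn 0 (by omega)))
          (fun m hm => by rw [e]; exact (hn (m + 1) (by omega)).symm)
        rw [← e]; exact this

theorem bal_of_lexC (s u : ℕ → Fin 2) (h : LexC s u) : Bal s := by
  by_contra hb
  obtain ⟨i, j, n, hi, hj, hi', hj', hm, _⟩ := unbal s hb
  rw [lexC_iff] at h
  obtain ⟨h1, h2⟩ := h
  have key : ∀ m, m < n → u m = s (j + 1 + m) := by
    intro m
    induction m using Nat.strong_induction_on with
    | _ m ih =>
      intro hmn
      have a1 := h1 j m hj (fun r hr => ih r hr (by omega))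
      have a2 := h2 i m hi (fun r hr => by rw [hm r (by omega)]; exact ih r hr (by omega))
      rw [hm m hmn] at a2
      exact le_antisymm a1 a2
  have a1 := h1 j n hj key
  have a2 := h2 i n hi (fun r hr => by rw [hm r hr]; exact key r hr)
  rw [show j + 1 + n = j + (n + 1) by ring, hj'] at a1
  rw [show i + 1 + n = i + (n + 1) by ring, hi'] at a2
  have := a2.trans a1
  simp at this

theorem bal_no (s : ℕ → Fin 2) (hb : Bal s) (i j n : ℕ) (hi : s i = 1) (hj : s j = 0)
    (hm : ∀ m < n, s (i + 1 + m) = s (j + 1 + m)) (hi' : s (i + 1 + n) = 1)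
    (hj' : s (j + 1 + n) = 0) : False := by
  have key : ∀ m ≤ n, SS s (i + 1 + m) - SS s (i + 1) = SS s (j + 1 + m) - SS s (j + 1) := by
    intro m
    induction m with
    | zero => simp
    | succ m ih =>
      intro h
      have a1 : SS s (i + 1 + (m + 1)) = SS s (i + 1 + m) + ((s (i + 1 + m) : ℕ) : ℤ) := SS_succ s _
      have a2 : SS s (j + 1 + (m + 1)) = SS s (j + 1 + m) + ((s (j + 1 + m) : ℕ) : ℤ) := SS_succ s _
      rw [hm m (by omega)] at a1
      have := ih (by omega)
      omega
  have k := key n le_rfl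
  have a1 := SS_succ s (i + 1 + n)
  have a2 := SS_succ s (j + 1 + n)
  have a3 := SS_succ s i
  have a4 := SS_succ s j
  rw [hi'] at a1
  rw [hj'] at a2
  rw [hi] at a3
  rw [hj] at a4
  simp at a1 a2 a3 a4
  have := hb i j (n + 2)
  rw [show i + (n + 2) = i + 1 + n + 1 by ring, show j + (n + 2) = j + 1 + n + 1 by ring] at this
  omega

theorem sturmian_of_bal (s : ℕ → Fin 2) (hap : ¬ UltimatelyPeriodic s) (hb : Bal s) :
    Sturmian s := by
  have hR : ∀ k, (RSp s k).ncard = 1 := by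
    intro k
    apply le_antisymm _ ((Set.ncard_pos (RSp_fin s k)).2 (RSp_nonempty s hap k))
    rw [Set.ncard_le_one (RSp_fin s k)]
    rintro _ ⟨a, b, rfl, hab, ha, hb1⟩ _ ⟨c, d, rfl, hcd, hc, hd⟩
    rw [window_eq_iff] at hab hcd ⊢
    by_contra hne
    -- last difference
    have key : ∀ m ≤ k, ∀ j < k, k - m ≤ j → s (a + j) = s (c + j) := by
      intro m
      induction m with
      | zero => intro _ j _ _; omega
      | succ m ih =>
        intro hm j hj hj'
        by_cases hjm : k - m ≤ j
        · exact ih (by omega) j hj hjm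
        · have hjj : k = j + 1 + m := by omega
          by_contra hne2
          have hag : ∀ r < m, s (a + (j + 1 + r)) = s (c + (j + 1 + r)) := by
            intro r hr
            exact ih (by omega) _ (by omega) (by omega)
          rcases (by omega : (s (a + j) = 0 ∧ s (c + j) = 1) ∨ (s (a + j) = 1 ∧ s (c + j) = 0))
            with h' | h'
          · refine bal_no s hb (d + j) (a + j) m (by rw [← hcd j hj]; exact h'.2) h'.1 ?_ ?_ ?_
            · intro r hr
              have e1 := hag r hr
              have e2 := hcd (j + 1 + r) (by omega)
              rw [show d + j + 1 + r = d + (j + 1 + r) by ring,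
                show a + j + 1 + r = a + (j + 1 + r) by ring, e1, e2]
            · rw [show d + j + 1 + m = d + k by omega]; exact hd
            · rw [show a + j + 1 + m = a + k by omega]; exact ha
          · refine bal_no s hb (b + j) (c + j) m (by rw [← hab j hj]; exact h'.1) h'.2 ?_ ?_ ?_
            · intro r hr
              have e1 := hag r hr
              have e2 := hab (j + 1 + r) (by omega)
              rw [show b + j + 1 + r = b + (j + 1 + r) by ring,
                show c + j + 1 + r = c + (j + 1 + r) by ring, ← e1, e2]
            · rw [show b + j + 1 + m = b + k by omega]; exact hb1
            · rw [show c + j + 1 + m = c + k by omega]; exact hc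
    exact hne (fun j hj => key k le_rfl j hj (by omega))
  have : ∀ k, complexity s k = k + 1 := by
    intro k
    induction k with
    | zero => rw [complexity_zero]
    | succ k ih => rw [complexity_succ, ih, hR]
  exact fun k _ => this k

theorem bal_of_sturmian (s : ℕ → Fin 2) (hap : ¬ UltimatelyPeriodic s) (hs : Sturmian s) :
    Bal s := by
  by_contra hb
  obtain ⟨i, j, n, hi, hj, hi', hj', hm, hpal⟩ := unbal s hb
  have hc : ∀ k, complexity s k = k + 1 := by
    intro k
    rcases k with _ | k
    · rw [complexity_zero]
    · exact hs _ (by omega)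
  have hR : ∀ k, ∃ z, RSp s k = {z} := by
    intro k
    rw [← Set.ncard_eq_one]
    have := complexity_succ s k
    rw [hc, hc] at this
    omega
  obtain ⟨w, hw⟩ := hR n
  obtain ⟨z, hz⟩ := hR (n + 1)
  have hzz : z ∈ RSp s (n + 1) := by rw [hz]; rfl
  obtain ⟨a, b, hza, hzb, ha, hb'⟩ := hzz
  have hw1 : window s (i + 1) n = w := by
    have : window s (i + 1) n ∈ RSp s n := by
      refine ⟨j + 1, i + 1, ?_, rfl, ?_, ?_⟩
      · rw [window_eq_iff]; exact hm
      · rw [← hj']; congr 1; ring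
      · rw [← hi']; congr 1; ring
    rw [hw] at this
    exact this
  have hw2 : window s (a + 1) n = w := by
    have : window s (a + 1) n ∈ RSp s n := by
      refine ⟨a + 1, b + 1, rfl, ?_, ?_, ?_⟩
      · have := hza.symm.trans hzb
        rw [window_eq_iff] at this ⊢
        intro r hr
        have := this (r + 1) (by omega)
        rwa [show a + (r + 1) = a + 1 + r by ring, show b + (r + 1) = b + 1 + r by ring] at this
      · rw [← ha]; congr 1; ring
      · rw [← hb']; congr 1; ring
    rw [hw] at this
    exact this
  have hai := (window_eq_iff _ _ _ _ _).1 (hw2.trans hw1.symm)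
  -- the occurrence of y w y
  obtain ⟨p, hp0, hp1, hpw⟩ : ∃ p, s p ≠ s a ∧ s (p + (n + 1)) = s p ∧
      ∀ m < n, s (p + 1 + m) = s (a + 1 + m) := by
    rcases (by omega : s a = 0 ∨ s a = 1) with h | h
    · exact ⟨i, by rw [hi, h]; decide, by rw [hi, hi'], fun m h => (hai m h).symm⟩
    · exact ⟨j, by rw [hj, h]; decide, by rw [hj, hj'], fun m h => by rw [hai m h, hm m h]⟩
  have hpp : ∀ m < n, s (p + 1 + m) = s (p + (n - m)) := by
    intro m hmn
    rw [hpw m hmn, hai m hmn, hpal m hmn]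
    have e1 := hpw (n - m - 1) (by omega)
    have e2 := hai (n - m - 1) (by omega)
    rw [show p + 1 + (n - m - 1) = p + (n - m) by omega] at e1
    rw [show i + 1 + (n - m - 1) = i + (n - m) by omega] at e2
    rw [e1, e2]
  have hno : ∀ t ≤ n + 1, window s (p + t) (n + 1) ≠ z := by
    intro t ht he
    rw [hza, window_eq_iff] at he
    have h0 := he 0 (by omega)
    simp only [add_zero] at h0
    rcases Nat.eq_zero_or_pos t with h1 | h1
    · subst h1; exact hp0 h0
    by_cases h2 : t = n + 1
    · subst h2; rw [hp1] at h0; exact hp0 h0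
    · have h3 := he (n + 1 - t) (by omega)
      rw [show p + t + (n + 1 - t) = p + (n + 1) by omega, hp1] at h3
      have h4 := hpw (n - t) (by omega)
      rw [show a + 1 + (n - t) = a + (n + 1 - t) by omega, ← h3] at h4
      have h5 := hpp (n - t) (by omega)
      rw [show p + (n - (n - t)) = p + t by congr 1; omega, h0, h4] at h5
      exact hp0 h5
  -- pigeonhole
  have hcard : (Set.range (fun i => window s i (n + 1)) \ {z}).ncard = n + 1 := by
    have h1 := hc (n + 1)
    unfold complexity at h1
    rw [factorSet_eq] at h1
    have hmem : z ∈ Set.range (fun i => window s i (n + 1)) := ⟨a, hza.symm⟩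
    rw [Set.ncard_sdiff_singleton_of_mem hmem, h1]
    rfl
  have hF : (Set.range (fun i => window s i (n + 1)) \ {z}).Finite := (range_fin s (n + 1)).sdiff
  obtain ⟨x, hx, y, hy, hxy, hxye⟩ := Finset.exists_ne_map_eq_of_card_lt_of_maps_to
    (s := Finset.range (n + 2)) (t := hF.toFinset)
    (f := fun t => window s (p + t) (n + 1))
    (by rw [← Set.ncard_eq_toFinset_card _ hF, hcard]; simp)
    (by
      intro t ht
      simp only [Finset.coe_range, Set.mem_Iio] at ht
      simp only [Set.Finite.coe_toFinset]
      exact ⟨⟨p + t, rfl⟩, hno t (by omega)⟩)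
  simp only [Finset.mem_range] at hx hy
  have fin : ∀ x y, x < n + 2 → y < n + 2 → x < y →
      window s (p + x) (n + 1) = window s (p + y) (n + 1) → False := by
    intro x y hx hy hlt he
    refine hap (per_of s (n + 1) (p + x) (p + y) (by omega) he fun c h1 h2 => ?_)
    rw [hz]
    have := hno (c - p) (by omega)
    rw [show p + (c - p) = c by omega] at this
    exact this
  rcases lt_or_gt_of_ne hxy with h | h
  · exact fin x y hx hy h hxye
  · exact fin y x hy hx h hxye.symm

theorem kfold (s : ℕ → Fin 2) (hb : Bal s) (i n k : ℕ) :
    (k : ℤ) * (SS s (i + n) - SS s i - 1) ≤ SS s (n * k) ∧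
    SS s (n * k) ≤ (k : ℤ) * (SS s (i + n) - SS s i + 1) := by
  induction k with
  | zero => simp [SS_zero]
  | succ k ih =>
    have h1 := hb i (n * k) n
    have h2 := hb (n * k) i n
    push_cast
    rw [show n * (k + 1) = n * k + n by ring]
    constructor <;> linarith [ih.1, ih.2]

theorem exists_slope (s : ℕ → Fin 2) (hb : Bal s) :
    ∃ α : ℝ, ∀ i n : ℕ, ((SS s (i + n) - SS s i : ℤ) : ℝ) - 1 ≤ n * α ∧
      (n : ℝ) * α ≤ ((SS s (i + n) - SS s i : ℤ) : ℝ) + 1 := by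
  let A : Set ℝ := {x | ∃ i k : ℕ, 1 ≤ k ∧ x = (((SS s (i + k) - SS s i : ℤ) : ℝ) - 1) / k}
  have hub : ∀ x ∈ A, ∀ j n : ℕ, 1 ≤ n → x ≤ (((SS s (j + n) - SS s j : ℤ) : ℝ) + 1) / n := by
    rintro x ⟨i, k, hk, rfl⟩ j n hn
    have hk' : (0 : ℝ) < k := by exact_mod_cast hk
    have hn' : (0 : ℝ) < n := by exact_mod_cast hn
    rw [div_le_div_iff₀ hk' hn']
    have h1 := (kfold s hb i k n).1
    have h2 := (kfold s hb j n k).2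
    rw [mul_comm k n] at h1
    have h3 := h1.trans h2
    have h4 : ((n : ℝ) * (((SS s (i + k) - SS s i : ℤ) : ℝ) - 1)) ≤
        (k : ℝ) * (((SS s (j + n) - SS s j : ℤ) : ℝ) + 1) := by exact_mod_cast h3
    linarith
  have hne : A.Nonempty := ⟨_, 0, 1, le_rfl, rfl⟩
  have hbd : BddAbove A := ⟨_, fun x hx => hub x hx 0 1 le_rfl⟩
  refine ⟨sSup A, fun i n => ?_⟩
  rcases Nat.eq_zero_or_pos n with h | h
  · subst h; simp
  · have hn' : (0 : ℝ) < n := by exact_mod_cast h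
    constructor
    · have := le_csSup hbd (show _ ∈ A from ⟨i, n, h, rfl⟩)
      rw [div_le_iff₀ hn'] at this
      linarith
    · have := csSup_le hne (fun x hx => hub x hx i n h)
      rw [le_div_iff₀ hn'] at this
      linarith

theorem ev_zero (f : ℕ → ℤ) (hf : ∀ n, 0 ≤ f n) (C : ℤ)
    (hC : ∀ n, ∑ i ∈ Finset.range n, f i ≤ C) : ∃ N, ∀ n ≥ N, f n = 0 := by
  obtain ⟨m, ⟨N, hN⟩, hmax⟩ := Int.exists_greatest_of_bdd
    (P := fun z => ∃ n, ∑ i ∈ Finset.range n, f i = z)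
    ⟨C, by rintro z ⟨n, rfl⟩; exact hC n⟩ ⟨_, 0, rfl⟩
  refine ⟨N, fun n hn => ?_⟩
  have h1 := hmax _ ⟨n + 1, rfl⟩
  rw [Finset.sum_range_succ] at h1
  have h2 : ∑ i ∈ Finset.range N, f i ≤ ∑ i ∈ Finset.range n, f i :=
    Finset.sum_le_sum_of_subset_of_nonneg (Finset.range_subset_range.2 hn) (fun i _ _ => hf i)
  have := hf n
  omega

theorem tele (g : ℕ → ℤ) (q N : ℕ) :
    ∑ i ∈ Finset.range N, (g (i + q) - g i) = ∑ i ∈ Finset.range q, (g (N + i) - g i) := by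
  induction N with
  | zero => simp
  | succ N ih =>
    rw [Finset.sum_range_succ, ih]
    have h : ∀ M, ∑ i ∈ Finset.range (q + 1), g (M + i) = ∑ i ∈ Finset.range q, g (M + i) + g (M + q) :=
      fun M => Finset.sum_range_succ _ _
    have h' : ∑ i ∈ Finset.range (q + 1), g (N + i) = ∑ i ∈ Finset.range q, g (N + 1 + i) + g N := by
      rw [Finset.sum_range_succ']
      simp [add_comm, add_left_comm]
    have := h N
    rw [Finset.sum_sub_distrib, Finset.sum_sub_distrib]
    linarith

theorem slope_irr (s : ℕ → Fin 2) (hap : ¬ UltimatelyPeriodic s) (hb : Bal s) (α : ℝ)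
    (hα : ∀ i n : ℕ, ((SS s (i + n) - SS s i : ℤ) : ℝ) - 1 ≤ n * α ∧
      (n : ℝ) * α ≤ ((SS s (i + n) - SS s i : ℤ) : ℝ) + 1) : Irrational α := by
  rintro ⟨r, hr⟩
  obtain ⟨q, p, hq, hpq⟩ : ∃ q : ℕ, ∃ p : ℤ, 1 ≤ q ∧ (q : ℝ) * α = p := by
    refine ⟨r.den, r.num, r.pos, ?_⟩
    rw [← hr]
    have := Rat.den_mul_eq_num r
    exact_mod_cast this
  let f : ℕ → ℤ := fun i => SS s (i + q) - SS s i - p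
  -- scaled discrepancy
  let g : ℕ → ℤ := fun i => q * SS s i - i * p
  have hq' : (0 : ℝ) < q := by exact_mod_cast hq
  have hg : ∀ i n, |g (i + n) - g i| ≤ q := by
    intro i n
    have h1 := hα i n
    have e : ((g (i + n) - g i : ℤ) : ℝ) = q * (((SS s (i + n) - SS s i : ℤ) : ℝ) - n * α) := by
      have : (p : ℝ) = q * α := hpq.symm
      simp only [g]
      push_cast
      rw [this]
      ring
    have h2 : |((g (i + n) - g i : ℤ) : ℝ)| ≤ q := by
      rw [e, abs_le]
      constructor <;> nlinarith [h1.1, h1.2]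
    exact_mod_cast h2
  have hfg : ∀ i, (q : ℤ) * f i = g (i + q) - g i := by
    intro i
    simp only [f, g]
    push_cast
    ring
  have hsum : ∀ N, |(q : ℤ) * ∑ i ∈ Finset.range N, f i| ≤ q * q := by
    intro N
    rw [Finset.mul_sum, Finset.sum_congr rfl (fun i _ => hfg i), tele]
    refine (Finset.abs_sum_le_sum_abs _ _).trans ?_
    refine (Finset.sum_le_sum (g := fun _ => (q : ℤ)) fun i _ => ?_).trans (by simp)
    rw [add_comm]
    exact hg i N
  have hqz : (0 : ℤ) < q := by exact_mod_cast hq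
  have hsum2 : ∀ N, |∑ i ∈ Finset.range N, f i| ≤ q := by
    intro N
    have := hsum N
    rw [abs_mul, abs_of_pos hqz] at this
    exact le_of_mul_le_mul_left this hqz
  have hev : ∃ N, ∀ n ≥ N, f n = 0 := by
    by_cases h : ∃ i, 0 < f i
    · obtain ⟨i, hi⟩ := h
      refine ev_zero f (fun n => ?_) q (fun n => (abs_le.1 (hsum2 n)).2)
      have := hb i n q
      simp only [f] at hi ⊢
      omega
    · push Not at h
      obtain ⟨N, hN⟩ := ev_zero (fun n => - f n) (fun n => by have := h n; omega) q
        (fun n => by rw [Finset.sum_neg_distrib]; have := (abs_le.1 (hsum2 n)).1; omega)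
      exact ⟨N, fun n hn => by have := hN n hn; omega⟩
  obtain ⟨N, hN⟩ := hev
  refine hap ⟨N, q, hq, fun n hn => ?_⟩
  have h1 := hN n hn
  have h2 := hN (n + 1) (by omega)
  simp only [f] at h1 h2
  have h3 := SS_succ s n
  have h4 := SS_succ s (n + q)
  rw [show n + 1 + q = n + q + 1 by ring] at h2
  apply v_inj
  omega

theorem small_eps (h : ℕ → ℝ) (N : ℕ) (hh : ∀ n, 1 ≤ n → 0 < h n) :
    ∃ ε > 0, ∀ n, 1 ≤ n → n ≤ N → ε < h n := by
  induction N with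
  | zero => exact ⟨1, one_pos, fun n _ _ => by omega⟩
  | succ N ih =>
    obtain ⟨ε, hε, h1⟩ := ih
    have := hh (N + 1) (by omega)
    refine ⟨min ε (h (N + 1) / 2), by positivity, fun n hn hn' => ?_⟩
    rcases Nat.lt_or_ge N n with h2 | h2
    · have : n = N + 1 := by omega
      subst this
      exact (min_le_right _ _).trans_lt (by linarith)
    · exact (min_le_left _ _).trans_lt (h1 n hn h2)

theorem main_bal (s : ℕ → Fin 2) (hap : ¬ UltimatelyPeriodic s) (hb : Bal s) :
    ∃ (α : ℝ) (c : ℕ → Fin 2), α ∈ Set.Ioo (0 : ℝ) 1 ∧ Irrational α ∧ IsCharSturmian α c ∧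
      LexC s c ∧ (∀ N, ∃ k, s k = 0 ∧ ∀ m < N, s (k + 1 + m) = c m) ∧
      (∀ N, ∃ k, s k = 1 ∧ ∀ m < N, s (k + 1 + m) = c m) := by
  obtain ⟨α, hα⟩ := exists_slope s hb
  have hirr := slope_irr s hap hb α hα
  have hne : ∀ n : ℕ, 1 ≤ n → ∀ z : ℤ, (n : ℝ) * α ≠ z := by
    intro n hn z
    have := hirr.natCast_mul (show n ≠ 0 by omega)
    exact this.ne_int z
  have hlo : ∀ i n : ℕ, ⌊(n : ℝ) * α⌋ ≤ SS s (i + n) - SS s i := by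
    intro i n
    rcases Nat.eq_zero_or_pos n with h | h
    · subst h; simp
    · have h1 := (hα i n).2
      have h2 := hne n h (SS s (i + n) - SS s i + 1)
      push_cast at h1 h2
      have h3 := lt_of_le_of_ne h1 h2
      have : ⌊(n : ℝ) * α⌋ < SS s (i + n) - SS s i + 1 := by
        rw [Int.floor_lt]; push_cast; exact h3
      omega
  have hhi : ∀ i n : ℕ, SS s (i + n) - SS s i ≤ ⌊(n : ℝ) * α⌋ + 1 := by
    intro i n
    have h1 := (hα i n).1
    have : SS s (i + n) - SS s i - 1 ≤ ⌊(n : ℝ) * α⌋ := by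
      rw [Int.le_floor]; push_cast; push_cast at h1; exact h1
    omega
  -- α in (0,1)
  have h01 : α ∈ Set.Ioo (0 : ℝ) 1 := by
    have hz : ∃ i, s i = 0 := by
      by_contra h
      push Not at h
      exact hap ⟨0, 1, le_rfl, fun n _ => by have := h n; have := h (n + 1); omega⟩
    have ho : ∃ i, s i = 1 := by
      by_contra h
      push Not at h
      exact hap ⟨0, 1, le_rfl, fun n _ => by have := h n; have := h (n + 1); omega⟩
    obtain ⟨a, ha⟩ := hz
    obtain ⟨b, hb'⟩ := ho
    have h1 := (hα a 1).2
    have h2 := (hα b 1).1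
    rw [SS_succ, ha] at h1
    rw [SS_succ, hb'] at h2
    simp at h1 h2
    have h3 := hne 1 le_rfl 1
    have h4 := hne 1 le_rfl 0
    simp at h3 h4
    exact ⟨lt_of_le_of_ne h2 (Ne.symm h4), lt_of_le_of_ne h1 h3⟩
  have hfl : ⌊α⌋ = 0 := by rw [Int.floor_eq_zero_iff]; exact ⟨h01.1.le, h01.2⟩
  let F : ℕ → ℤ := fun n => ⌊(n : ℝ) * α⌋
  have hF1 : F 1 = 0 := by simp only [F]; simpa using hfl
  have hFs : ∀ n, F (n + 1) - F n = 0 ∨ F (n + 1) - F n = 1 := by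
    intro n
    have h1 : F n ≤ F (n + 1) := by
      apply Int.floor_mono; push_cast; nlinarith [h01.1]
    have h2 : F (n + 1) ≤ F n + 1 := by
      simp only [F]
      rw [← Int.floor_add_one]
      apply Int.floor_mono; push_cast; nlinarith [h01.2]
    omega
  let c : ℕ → Fin 2 := fun n => if F (n + 2) - F (n + 1) = 1 then 1 else 0
  have hc : ∀ n, ((c n : ℕ) : ℤ) = F (n + 2) - F (n + 1) := by
    intro n
    rcases hFs (n + 1) with h | h
    · simp only [c]; rw [h]; simp
    · simp only [c]; rw [h]; simp
  have hchar : IsCharSturmian α c := by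
    intro n
    rw [hc]
    simp only [F]
    push_cast
    rfl
  have hbd : ∀ n, |(SS s n : ℝ) - n * α| ≤ 1 := by
    intro n
    have := hα 0 n
    rw [SS_zero, zero_add, sub_zero] at this
    rw [abs_le]
    constructor <;> linarith [this.1, this.2]
  have hpre : ∀ k m n, (∀ j < n, c j = s (k + 1 + j)) → m ≤ n →
      SS s (k + 1 + m) - SS s (k + 1) = F (m + 1) := by
    intro k m n hag hm
    induction m with
    | zero => simp [hF1]
    | succ m ih =>
      have h1 := ih (by omega)
      have h2 := SS_succ s (k + 1 + m)
      have h3 := hc m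
      rw [hag m (by omega)] at h3
      rw [show k + 1 + (m + 1) = k + 1 + m + 1 by ring, show m + 1 + 1 = m + 2 by ring]
      omega
  refine ⟨α, c, h01, hirr, hchar, ?_, ?_, ?_⟩
  · rw [lexC_iff]
    constructor
    · intro k n hk hag
      by_contra hlt
      have hs0 : c n = 1 ∧ s (k + 1 + n) = 0 := by omega
      have h1 := hpre k n n hag le_rfl
      have h2 := hc n
      have h3 := SS_succ s k
      have h4 := SS_succ s (k + 1 + n)
      rw [hs0.1] at h2
      rw [hk] at h3
      rw [hs0.2] at h4
      simp at h2 h3 h4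
      have h5 : F (n + 2) ≤ _ := hlo k (n + 2)
      rw [show k + (n + 2) = k + 1 + n + 1 by ring] at h5
      omega
    · intro k n hk hag
      by_contra hlt
      have hs0 : c n = 0 ∧ s (k + 1 + n) = 1 := by omega
      have h1 := hpre k n n hag le_rfl
      have h2 := hc n
      have h3 := SS_succ s k
      have h4 := SS_succ s (k + 1 + n)
      rw [hs0.1] at h2
      rw [hk] at h3
      rw [hs0.2] at h4
      simp at h2 h3 h4
      have h5 : _ ≤ F (n + 2) + 1 := hhi k (n + 2)
      rw [show k + (n + 2) = k + 1 + n + 1 by ring] at h5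
      omega
  · intro N
    obtain ⟨ε, hε, he⟩ := small_eps (fun n => (⌊(n : ℝ) * α⌋ : ℝ) + 1 - n * α) (N + 1)
      (fun n _ => by have := Int.lt_floor_add_one ((n : ℝ) * α); linarith)
    have hB : BddAbove (Set.range fun n : ℕ => (SS s n : ℝ) - n * α) :=
      ⟨1, by rintro _ ⟨n, rfl⟩; exact (abs_le.1 (hbd n)).2⟩
    obtain ⟨_, ⟨k, rfl⟩, hk⟩ := exists_lt_of_lt_csSup (Set.range_nonempty _)
      (show sSup (Set.range fun n : ℕ => (SS s n : ℝ) - n * α) - ε < _ by linarith)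
    have hcnt : ∀ n, 1 ≤ n → n ≤ N + 1 → SS s (k + n) - SS s k = F n := by
      intro n h1 h2
      apply le_antisymm _ (hlo k n)
      have h3 := le_csSup hB ⟨k + n, rfl⟩
      have h4 := he n h1 h2
      simp only at h3 h4 hk
      push_cast at h3
      have : ((SS s (k + n) - SS s k : ℤ) : ℝ) < ((F n + 1 : ℤ) : ℝ) := by
        simp only [F]; push_cast; linarith
      have : SS s (k + n) - SS s k < F n + 1 := by exact_mod_cast this
      exact Int.lt_add_one_iff.mp this
    refine ⟨k, ?_, fun m hm => ?_⟩
    · have h1 := hcnt 1 le_rfl (by omega)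
      rw [SS_succ, hF1] at h1
      rcases v01 (s k) with h | h
      · exact h.2
      · omega
    · have h1 := hcnt (m + 1) (by omega) (by omega)
      have h2 := hcnt (m + 2) (by omega) (by omega)
      have h3 := SS_succ s (k + 1 + m)
      have h4 := hc m
      rw [show k + (m + 1) = k + 1 + m by ring] at h1
      rw [show k + (m + 2) = k + 1 + m + 1 by ring] at h2
      apply v_inj
      omega
  · intro N
    obtain ⟨ε, hε, he⟩ := small_eps (fun n => n * α - (⌊(n : ℝ) * α⌋ : ℝ)) (N + 1)
      (fun n hn => by
        have := lt_of_le_of_ne (Int.floor_le ((n : ℝ) * α)) (hne n hn _).symm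
        linarith)
    have hB : BddBelow (Set.range fun n : ℕ => (SS s n : ℝ) - n * α) :=
      ⟨-1, by rintro _ ⟨n, rfl⟩; exact (abs_le.1 (hbd n)).1⟩
    obtain ⟨_, ⟨k, rfl⟩, hk⟩ := exists_lt_of_csInf_lt (Set.range_nonempty _)
      (show _ < sInf (Set.range fun n : ℕ => (SS s n : ℝ) - n * α) + ε by linarith)
    have hcnt : ∀ n, 1 ≤ n → n ≤ N + 1 → SS s (k + n) - SS s k = F n + 1 := by
      intro n h1 h2
      apply le_antisymm (hhi k n)
      have h3 := csInf_le hB ⟨k + n, rfl⟩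
      have h4 := he n h1 h2
      simp only at h3 h4 hk
      push_cast at h3
      have : ((F n : ℤ) : ℝ) < ((SS s (k + n) - SS s k : ℤ) : ℝ) := by
        simp only [F]; push_cast; linarith
      have : F n < SS s (k + n) - SS s k := by exact_mod_cast this
      exact Int.add_one_le_iff.mpr this
    refine ⟨k, ?_, fun m hm => ?_⟩
    · have h1 := hcnt 1 le_rfl (by omega)
      rw [SS_succ, hF1] at h1
      rcases v01 (s k) with h | h
      · omega
      · exact h.2
    · have h1 := hcnt (m + 1) (by omega) (by omega)
      have h2 := hcnt (m + 2) (by omega) (by omega)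
      have h3 := SS_succ s (k + 1 + m)
      have h4 := hc m
      rw [show k + (m + 1) = k + 1 + m by ring] at h1
      rw [show k + (m + 2) = k + 1 + m + 1 by ring] at h2
      apply v_inj
      omega

theorem lex_unique (s u c : ℕ → Fin 2) (hu : LexC s u)
    (h0 : ∀ N, ∃ k, s k = 0 ∧ ∀ m < N, s (k + 1 + m) = c m)
    (h1 : ∀ N, ∃ k, s k = 1 ∧ ∀ m < N, s (k + 1 + m) = c m) : u = c := by
  rw [lexC_iff] at hu
  funext n
  induction n using Nat.strong_induction_on with
  | _ n ih =>
    obtain ⟨k, hk, hm⟩ := h0 (n + 1)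
    obtain ⟨l, hl, hml⟩ := h1 (n + 1)
    have a := hu.1 k n hk (fun m hmn => by rw [hm m (by omega), ih m hmn])
    have b := hu.2 l n hl (fun m hmn => by rw [hml m (by omega), ih m hmn])
    rw [hm n (by omega)] at a
    rw [hml n (by omega)] at b
    exact le_antisymm a b

theorem pre_factor (s c : ℕ → Fin 2) (x : Fin 2)
    (h : ∀ N, ∃ k, s k = x ∧ ∀ m < N, s (k + 1 + m) = c m) (n : ℕ) :
    IsFactor s (window (pre x c) 0 n) := by
  obtain ⟨k, hk, hm⟩ := h n
  refine ⟨k, ?_⟩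
  rw [window_len, window_eq_iff]
  rintro (_ | j) hj
  · simp [pre, hk]
  · rw [zero_add, show k + (j + 1) = k + 1 + j by ring, hm j (by omega)]
    rfl

/-- An aperiodic binary sequence `s` is Sturmian iff there is a sequence `u`
with `0·u ≤ Tᵏ(s) ≤ 1·u` for all `k`; moreover such `u` is then unique, it is
characteristic Sturmian, and all prefixes of `0·u` and `1·u` are factors of `s`
(so `0·u` and `1·u` are the inf and sup of the shift-orbit of `s`). -/
theorem stmt6 (s : ℕ → Fin 2) (hap : ¬ UltimatelyPeriodic s) :
    (Sturmian s ↔ ∃ u : ℕ → Fin 2, ∀ k : ℕ,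
        SeqLe (pre 0 u) (shiftMap^[k] s) ∧ SeqLe (shiftMap^[k] s) (pre 1 u)) ∧
    (Sturmian s →
      ∃! u : ℕ → Fin 2, ∀ k : ℕ,
        SeqLe (pre 0 u) (shiftMap^[k] s) ∧ SeqLe (shiftMap^[k] s) (pre 1 u)) ∧
    (Sturmian s → ∀ u : ℕ → Fin 2,
      (∀ k : ℕ, SeqLe (pre 0 u) (shiftMap^[k] s) ∧ SeqLe (shiftMap^[k] s) (pre 1 u)) →
      (∃ α : ℝ, α ∈ Set.Ioo (0 : ℝ) 1 ∧ Irrational α ∧ IsCharSturmian α u) ∧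
      (∀ k : ℕ, IsFactor s (window (pre 0 u) 0 k) ∧ IsFactor s (window (pre 1 u) 0 k))) := by
  have hBal : Sturmian s → ∃ (α : ℝ) (c : ℕ → Fin 2), α ∈ Set.Ioo (0 : ℝ) 1 ∧ Irrational α ∧
      IsCharSturmian α c ∧
      LexC s c ∧ (∀ N, ∃ k, s k = 0 ∧ ∀ m < N, s (k + 1 + m) = c m) ∧
      (∀ N, ∃ k, s k = 1 ∧ ∀ m < N, s (k + 1 + m) = c m) := fun hs =>
    main_bal s hap (bal_of_sturmian s hap hs)
  refine ⟨⟨fun hs => ?_, ?_⟩, fun hs => ?_, fun hs u hu => ?_⟩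
  · obtain ⟨α, c, _, _, _, hl, _⟩ := hBal hs
    exact ⟨c, hl⟩
  · rintro ⟨u, hu⟩
    exact sturmian_of_bal s hap (bal_of_lexC s u hu)
  · obtain ⟨α, c, _, _, _, hl, h0, h1⟩ := hBal hs
    exact ⟨c, hl, fun u hu => lex_unique s u c hu h0 h1⟩
  · obtain ⟨α, c, ha, hi, hc, hl, h0, h1⟩ := hBal hs
    have := lex_unique s u c hu h0 h1
    subst this
    exact ⟨⟨α, ha, hi, hc⟩, fun k => ⟨pre_factor s u 0 h0 k, pre_factor s u 1 h1 k⟩⟩
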